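/- Let $(M, g)$ be a $(2n+1)$-dimensional smooth Riemannian manifold with Levi-Civita connection $\nabla$ and Ricci tensor $S$, where $S(Y,Z)$ is the trace of $X \mapsto R(X,Y)Z$ and $R(X,Y)Z = \nabla_X\nabla_Y Z - \nabla_Y\nabla_X Z - \nabla_{[X,Y]}Z$. Let $(\varphi, \xi, \eta)$ be a Kenmotsu structure on $(M,g)$, that is, a smooth $(1,1)$-tensor field $\varphi$, a smooth vector field $\xi$ and a $1$-form $\eta$ with $$\varphi^2 = -I + \eta\otimes\xi,\quad \eta(\xi) = 1,\quad \eta(X) = g(X,\xi),\quad g(\varphi X,\varphi Y) = g(X,Y) - \eta(X)\eta(Y),$$ $$(\nabla_X\varphi)Y = g(\varphi X, Y)\,\xi - \eta(Y)\,\varphi X$$ for all vector fields $X, Y$. Suppose that $(g, V, \lambda, \mu)$ is a conformal $\eta$-Ricci soliton on $M$ with constant conformal pressure $p$, that is, $V$ is a smooth vector field, $\lambda, \mu, p$ are real constants, and $$\mathcal{L}_V g + 2S + \Bigl[2\lambda - \Bigl(p + \frac{2}{2n+1}\Bigr)\Bigr] g + 2\mu\, \eta\otimes\eta = 0,$$ where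 $\mathcal{L}_V$ is the Lie derivative along $V$. Then $(\mathcal{L}_V S)(\xi,\xi) = 0$. -/

import Mathlib

open Bundle FiberBundle VectorField
open scoped Manifold ContDiff

noncomputable section

section Riemannian

variable {E : Type*} [NormedAddCommGroup E] [NormedSpace ℝ E] [FiniteDimensional ℝ E]
  {H : Type*} [TopologicalSpace H] {I : ModelWithCorners ℝ E H}
  {M : Type*} [TopologicalSpace M] [ChartedSpace H M] [IsManifold I ∞ M]

/-- A vector field `X` on `M` is smooth: it is a `C^∞` section of the tangent bundle. -/
def IsSmoothField (X : Π x : M, TangentSpace I x) : Prop :=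
  ContMDiff I (I.prod 𝓘(ℝ, E)) ∞ (fun x ↦ (⟨x, X x⟩ : TotalSpace E (TangentSpace I : M → Type _)))

/-- The `(1,1)`-tensor field `φ` on `M` is smooth: it is a `C^∞` section of the bundle
`Hom(TM, TM)`. -/
def IsSmoothEndField (φ : Π x : M, TangentSpace I x →L[ℝ] TangentSpace I x) : Prop :=
  ContMDiff I (I.prod 𝓘(ℝ, E →L[ℝ] E)) ∞
    (fun x ↦ (⟨x, φ x⟩ :
      TotalSpace (E →L[ℝ] E) (fun x : M ↦ TangentSpace I x →L[ℝ] TangentSpace I x)))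

/-- The covariant derivative `∇_X Y` of the vector field `Y` along the vector field `X`. -/
def covDeriv (nabla : CovariantDerivative I E (TangentSpace I : M → Type _))
    (X Y : Π x : M, TangentSpace I x) : Π x : M, TangentSpace I x :=
  fun x ↦ nabla Y x (X x)

/-- The curvature `R(X, Y)Z = ∇_X ∇_Y Z - ∇_Y ∇_X Z - ∇_[X,Y] Z`. -/
def curvature (nabla : CovariantDerivative I E (TangentSpace I : M → Type _))
    (X Y Z : Π x : M, TangentSpace I x) : Π x : M, TangentSpace I x :=
  covDeriv nabla X (covDeriv nabla Y Z) - covDeriv nabla Y (covDeriv nabla X Z)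
    - covDeriv nabla (mlieBracket I X Y) Z

/-- The Lie derivative along `V` of a covariant `2`-tensor field `T`, where `T` is given by its
values `T(X, Y) : M → ℝ` on vector fields:
`(L_V T)(X, Y) = V(T(X, Y)) - T([V, X], Y) - T(X, [V, Y])`. -/
def lieDerivTwoTensor (V : Π x : M, TangentSpace I x)
    (T : (Π x : M, TangentSpace I x) → (Π x : M, TangentSpace I x) → M → ℝ)
    (X Y : Π x : M, TangentSpace I x) : M → ℝ :=
  fun x ↦ mvfderiv I (T X Y) x (V x) - T (mlieBracket I V X) Y x - T X (mlieBracket I V Y) x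

variable [RiemannianBundle (fun x : M ↦ TangentSpace I x)]

/-- The Riemannian metric as a `2`-tensor field: `g(X, Y)`. -/
def metricTensor (X Y : Π x : M, TangentSpace I x) : M → ℝ :=
  fun x ↦ inner ℝ (X x) (Y x)

/-- The Ricci tensor `S(Y, Z)` for smooth vector fields `Y`, `Z`: at the point `x`, the trace of the
linear endomorphism `X ↦ R(X, Y)Z` of the tangent space at `x`, computed in an orthonormal basis
`e` of that space. The value at `x` of `R(X, Y)Z` depends on `X` only through `X x`, so
each `e i` is extended to a vector field that is smooth near `x`. -/
def ricci (nabla : CovariantDerivative I E (TangentSpace I : M → Type _))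
    (Y Z : Π x : M, TangentSpace I x) : M → ℝ :=
  fun x ↦
    haveI : FiniteDimensional ℝ (TangentSpace I x) := inferInstanceAs (FiniteDimensional ℝ E)
    ∑ i, inner ℝ (curvature nabla (extend E (stdOrthonormalBasis ℝ (TangentSpace I x) i)) Y Z x)
      (stdOrthonormalBasis ℝ (TangentSpace I x) i)

/-- `nabla` is the Levi-Civita connection of the Riemannian metric: the smooth affine connection
that is torsion-free and compatible with the metric, `X(g(Y, Z)) = g(∇_X Y, Z) + g(Y, ∇_X Z)`. -/
structure IsLeviCivita (nabla : CovariantDerivative I E (TangentSpace I : M → Type _)) : Prop where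
  smooth : nabla.ContMDiffCovariantDerivative ∞
  torsion_eq_zero : nabla.torsion = 0
  metric : ∀ X Y Z : (Π x : M, TangentSpace I x),
    IsSmoothField X → IsSmoothField Y → IsSmoothField Z → ∀ x,
      mvfderiv I (metricTensor Y Z) x (X x)
        = metricTensor (covDeriv nabla X Y) Z x + metricTensor Y (covDeriv nabla X Z) x

/-- `(φ, ξ, η)` is an almost contact metric structure on the Riemannian manifold `M`.
Smoothness of `η` follows from `η(X) = g(X, ξ)`. -/
structure IsAlmostContactMetric (φ : Π x : M, TangentSpace I x →L[ℝ] TangentSpace I x)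
    (ξ : Π x : M, TangentSpace I x) (η : Π x : M, TangentSpace I x →L[ℝ] ℝ) : Prop where
  smooth_phi : IsSmoothEndField φ
  smooth_xi : IsSmoothField ξ
  phi_sq : ∀ x (v : TangentSpace I x), φ x (φ x v) = -v + η x v • ξ x
  eta_xi : ∀ x, η x (ξ x) = 1
  eta_eq : ∀ x (v : TangentSpace I x), η x v = inner ℝ v (ξ x)
  inner_phi : ∀ x (v w : TangentSpace I x),
    inner ℝ (φ x v) (φ x w) = inner ℝ v w - η x v * η x w

/-- `(φ, ξ, η)` is a Kenmotsu structure on the Riemannian manifold `M` with Levi-Civita connection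
`nabla`: an almost contact metric structure such that
`(∇_X φ)Y = ∇_X (φ Y) - φ (∇_X Y)` equals `g(φ X, Y) ξ - η(Y) φ X` for all smooth vector fields
`X`, `Y`. -/
structure IsKenmotsu (nabla : CovariantDerivative I E (TangentSpace I : M → Type _))
    (φ : Π x : M, TangentSpace I x →L[ℝ] TangentSpace I x)
    (ξ : Π x : M, TangentSpace I x) (η : Π x : M, TangentSpace I x →L[ℝ] ℝ) : Prop
    extends IsAlmostContactMetric φ ξ η where
  leviCivita : IsLeviCivita nabla
  kenmotsu : ∀ X Y : (Π x : M, TangentSpace I x), IsSmoothField X → IsSmoothField Y → ∀ x,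
    covDeriv nabla X (fun y ↦ φ y (Y y)) x - φ x (covDeriv nabla X Y x)
      = (inner ℝ (φ x (X x)) (Y x) : ℝ) • ξ x - η x (Y x) • φ x (X x)

/-- `(g, V, lam, mu)` is a conformal `η`-Ricci soliton with conformal pressure `p`:
`L_V g + 2 S + [2 lam - (p + 2 / dim M)] g + 2 mu η ⊗ η = 0`, with `V` a smooth vector field. -/
structure IsConformalEtaRicciSoliton
    (nabla : CovariantDerivative I E (TangentSpace I : M → Type _))
    (η : Π x : M, TangentSpace I x →L[ℝ] ℝ) (V : Π x : M, TangentSpace I x)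
    (lam mu p : ℝ) : Prop where
  smooth : IsSmoothField V
  eq_zero : ∀ X Y : (Π x : M, TangentSpace I x), IsSmoothField X → IsSmoothField Y → ∀ x,
    lieDerivTwoTensor V metricTensor X Y x + 2 * ricci nabla X Y x
      + (2 * lam - (p + 2 / (Module.finrank ℝ E : ℝ))) * metricTensor X Y x
      + 2 * mu * (η x (X x) * η x (Y x)) = 0

end Riemannian

end

/-- The algebraic structure carried by the smooth vector fields `𝔛` of a Riemannian manifold, as a
module over the smooth functions `A`: the action on functions, the Levi-Civita connection, the
metric, and the pointwise trace of endomorphisms. -/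
structure RiemannianFieldAlgebra (A 𝔛 : Type*) [CommRing A] [Algebra ℝ A]
    [AddCommGroup 𝔛] [Module A 𝔛] where
  /-- The derivative of a function along a vector field. -/
  D : 𝔛 →ₗ[A] Derivation ℝ A A
  /-- The connection. -/
  nab : 𝔛 →ₗ[A] 𝔛 →+ 𝔛
  /-- The metric. -/
  g : 𝔛 →ₗ[A] 𝔛 →ₗ[A] A
  /-- The trace. -/
  tr : Module.End A 𝔛 →ₗ[A] A
  leibniz : ∀ X (f : A) Y, nab X (f • Y) = D X f • Y + f • nab X Y
  metric : ∀ X Y Z, D X (g Y Z) = g (nab X Y) Z + g Y (nab X Z)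
  g_symm : ∀ X Y, g X Y = g Y X
  g_nondeg : ∀ X, (∀ Y, g X Y = 0) → X = 0
  jacobi : ∀ X Y Z : 𝔛,
    (nab X (nab Y Z - nab Z Y) - nab (nab Y Z - nab Z Y) X)
      = (nab (nab X Y - nab Y X) Z - nab Z (nab X Y - nab Y X))
        + (nab Y (nab X Z - nab Z X) - nab (nab X Z - nab Z X) Y)
  tr_smulRight : ∀ (α : 𝔛 →ₗ[A] A) Y, tr (α.smulRight Y) = α Y
  eq_zero_of_locally : ∀ f : A, (∀ (χ : A) (k : ℕ) (E : Fin k → 𝔛) (θ : Fin k → 𝔛 →ₗ[A] A),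
    (∀ X, χ • X = ∑ i, θ i X • E i) → χ * f = 0) → f = 0

namespace RiemannianFieldAlgebra

variable {A 𝔛 : Type*} [CommRing A] [Algebra ℝ A] [AddCommGroup 𝔛] [Module A 𝔛]
  (L : RiemannianFieldAlgebra A 𝔛)

/-- The Lie bracket, expressed through the torsion-free connection. -/
def br (X Y : 𝔛) : 𝔛 := L.nab X Y - L.nab Y X

/-- The curvature, as an endomorphism in its first argument. -/
def curv (Y Z : 𝔛) : Module.End A 𝔛 where
  toFun X := L.nab X (L.nab Y Z) - L.nab Y (L.nab X Z) - L.nab (L.br X Y) Z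
  map_add' X X' := by
    simp only [br, map_add, map_sub, AddMonoidHom.add_apply, AddMonoidHom.sub_apply]; abel
  map_smul' f X := by
    simp only [br, map_sub, map_smul, AddMonoidHom.smul_apply, AddMonoidHom.sub_apply, L.leibniz,
      RingHom.id_apply, map_add, AddMonoidHom.add_apply]
    module

lemma curv_apply (X Y Z : 𝔛) : L.curv Y Z X
    = L.nab X (L.nab Y Z) - L.nab Y (L.nab X Z) - L.nab (L.br X Y) Z := rfl

/-- The Lie derivative of a `2`-tensor. -/
def lie (V : 𝔛) (T : 𝔛 → 𝔛 → A) (X Y : 𝔛) : A :=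
  L.D V (T X Y) - T (L.br V X) Y - T X (L.br V Y)

lemma br_jacobi (X Y Z : 𝔛) : L.br X (L.br Y Z) = L.br (L.br X Y) Z + L.br Y (L.br X Z) :=
  L.jacobi X Y Z

lemma br_smul_right (X : 𝔛) (f : A) (Y : 𝔛) : L.br X (f • Y) = L.D X f • Y + f • L.br X Y := by
  simp only [br, L.leibniz, map_smul, AddMonoidHom.smul_apply]; module

lemma br_add_right (X Y Z : 𝔛) : L.br X (Y + Z) = L.br X Y + L.br X Z := by
  simp only [br, map_add, AddMonoidHom.add_apply]; abel

lemma D_br_apply {ξ : 𝔛} (hξ : L.g ξ ξ = 1) (X Y : 𝔛) (f : A) :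
    L.D (L.br X Y) f = L.D X (L.D Y f) - L.D Y (L.D X f) := by
  have h := L.br_jacobi X Y (f • ξ)
  simp only [br_smul_right, br_add_right, L.br_jacobi X Y ξ] at h
  have h2 := congrArg (fun Z ↦ L.g Z ξ) h
  simp only [map_add, map_smul, LinearMap.add_apply, LinearMap.smul_apply, smul_eq_mul, hξ] at h2
  linear_combination -h2

lemma D_two (X : 𝔛) : L.D X 2 = 0 := by exact_mod_cast (L.D X).map_natCast 2

/-- The Lie derivative of a `1`-form. -/
def lieForm (Z : 𝔛) (θ : 𝔛 →ₗ[A] A) : 𝔛 →ₗ[A] A where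
  toFun X := L.D Z (θ X) - θ (L.br Z X)
  map_add' X Y := by simp only [map_add, L.br_add_right]; ring
  map_smul' f X := by
    simp only [map_smul, map_add, L.br_smul_right, smul_eq_mul, Derivation.leibniz,
      RingHom.id_apply]
    ring

/-- Lie derivatives commute with the trace. -/
lemma tr_eq_D_tr (Z : 𝔛) (P Q : Module.End A 𝔛)
    (hQ : ∀ X, Q X = L.br Z (P X) - P (L.br Z X)) : L.tr Q = L.D Z (L.tr P) := by
  refine sub_eq_zero.1 <| L.eq_zero_of_locally _ fun χ k E θ hχ ↦ ?_
  have hPX (X : 𝔛) : χ • P X = ∑ i, θ i X • P (E i) := by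
    rw [← map_smul, hχ, map_sum]; simp
  have hP : χ • P = ∑ i, (θ i).smulRight (P (E i)) := by
    ext X; simp [hPX, LinearMap.sum_apply]
  have br_sum (F : Fin k → 𝔛) : L.br Z (∑ i, F i) = ∑ i, L.br Z (F i) :=
    map_sum (AddMonoidHom.mk' (L.br Z) (L.br_add_right Z)) F Finset.univ
  have hQ' : χ • Q + L.D Z χ • P = ∑ i, ((L.lieForm Z (θ i)).smulRight (P (E i))
      + (θ i).smulRight (L.br Z (P (E i)))) := by
    ext X
    have e := L.br_smul_right Z χ (P X)
    rw [hPX, br_sum] at e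
    simp only [L.br_smul_right] at e
    simp only [LinearMap.add_apply, LinearMap.smul_apply, hQ, LinearMap.sum_apply,
      LinearMap.smulRight_apply, lieForm, LinearMap.coe_mk, AddHom.coe_mk, smul_sub, hPX]
    rw [add_comm, ← add_sub_assoc, ← e, ← Finset.sum_sub_distrib]
    exact Finset.sum_congr rfl fun i _ ↦ by module
  have h1 := congrArg L.tr hP
  have h2 := congrArg L.tr hQ'
  simp only [map_add, map_smul, map_sum, L.tr_smulRight, smul_eq_mul, lieForm, LinearMap.coe_mk,
    AddHom.coe_mk, sub_add_cancel] at h1 h2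
  have h3 := congrArg (L.D Z) h1
  rw [map_sum, ← h2, Derivation.leibniz, smul_eq_mul, smul_eq_mul] at h3
  linear_combination -h3

lemma eq_of_two_mul_eq {a b : A} (h : 2 * a = 2 * b) : a = b := by
  have h2 := congrArg (fun t ↦ algebraMap ℝ A (1 / 2) * t) h
  have e : algebraMap ℝ A (1 / 2) * 2 = 1 := by
    rw [← map_ofNat (algebraMap ℝ A) 2, ← map_mul]; norm_num
  simpa only [← mul_assoc, e, one_mul] using h2

lemma g_ext {X Y : 𝔛} (h : ∀ Z, L.g X Z = L.g Y Z) : X = Y :=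
  sub_eq_zero.1 <| L.g_nondeg _ fun Z ↦ by simp [h]

lemma curv_swap (X Y Z : 𝔛) : L.curv Y Z X = - L.curv X Z Y := by
  simp only [curv_apply, br, map_sub, AddMonoidHom.sub_apply]; abel

lemma curv_bianchi (X Y Z : 𝔛) : L.curv Y Z X + L.curv Z X Y + L.curv X Y Z = 0 := by
  have h := L.br_jacobi X Y Z
  simp only [curv_apply, br, map_sub, AddMonoidHom.sub_apply] at h ⊢
  rw [← sub_eq_zero] at h
  rw [← h]; abel

lemma g_curv_skew {ξ : 𝔛} (hξ : L.g ξ ξ = 1) (X Y Z W : 𝔛) :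
    L.g (L.curv Y Z X) W = - L.g (L.curv Y W X) Z := by
  have h := L.D_br_apply hξ X Y (L.g Z W)
  simp only [L.metric, map_add] at h
  simp only [curv_apply, map_sub, LinearMap.sub_apply]
  rw [L.g_symm (L.nab X (L.nab Y W)) Z, L.g_symm (L.nab Y (L.nab X W)) Z,
    L.g_symm (L.nab (L.br X Y) W) Z]
  linear_combination -h

lemma g_curv_pair_symm {ξ : 𝔛} (hξ : L.g ξ ξ = 1) (X Y Z W : 𝔛) :
    L.g (L.curv Y Z X) W = L.g (L.curv W X Z) Y := by
  have b (X Y Z W : 𝔛) :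
    L.g (L.curv Y Z X) W + L.g (L.curv Z X Y) W + L.g (L.curv X Y Z) W = 0 := by
    simpa using congrArg (fun T ↦ L.g T W) (L.curv_bianchi X Y Z)
  have a (X Y Z W : 𝔛) : L.g (L.curv Y Z X) W = - L.g (L.curv X Z Y) W := by
    rw [L.curv_swap X Y Z]; simp
  have s := L.g_curv_skew hξ
  apply eq_of_two_mul_eq
  linear_combination b X Y Z W + b Y Z W X - b Z W X Y - b W X Y Z - s Y Z W X - s Z W Y X
    - a W Y Z X + a W X Z Y - s X W Z Y + a X Z W Y - s Z X W Y + a W X Y Z + s X Y W Z + s Y W X Z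

/-- The commutator of Lie derivatives of the metric. -/
lemma lie_lie_metric {ξ : 𝔛} (hξ : L.g ξ ξ = 1) (V W X Y : 𝔛) :
    L.lie V (L.lie W fun X Y ↦ L.g X Y) X Y - L.lie W (L.lie V fun X Y ↦ L.g X Y) X Y
      = L.lie (L.br V W) (fun X Y ↦ L.g X Y) X Y := by
  simp only [lie, L.D_br_apply hξ, map_sub, L.br_jacobi V W, map_add, LinearMap.add_apply]
  ring

/-- `ξ` is a unit field satisfying `∇_X ξ = X - η(X) ξ` with `η = g(·, ξ)`. -/
structure IsKenmotsuField (ξ : 𝔛) : Prop where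
  unit : L.g ξ ξ = 1
  nab_eq : ∀ X, L.nab X ξ = X - L.g X ξ • ξ

namespace IsKenmotsuField

variable {L} {ξ : 𝔛}

lemma D_eta (h : L.IsKenmotsuField ξ) (X Y : 𝔛) :
    L.D X (L.g Y ξ) = L.g (L.nab X Y) ξ + L.g X Y - L.g X ξ * L.g Y ξ := by
  rw [L.metric, h.nab_eq]
  simp only [map_sub, map_smul, smul_eq_mul, L.g_symm Y X]
  ring

lemma curv_xi (h : L.IsKenmotsuField ξ) (X Y : 𝔛) : L.curv Y ξ X = L.g X ξ • Y - L.g Y ξ • X := by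
  rw [curv_apply, h.nab_eq (L.br X Y)]
  simp only [h.nab_eq, map_sub, L.leibniz, h.D_eta, br, LinearMap.sub_apply, L.g_symm Y X]
  module

lemma curv_xi_left (h : L.IsKenmotsuField ξ) (X Y : 𝔛) :
    L.curv X Y ξ = L.g Y ξ • X - L.g X Y • ξ := by
  refine L.g_ext fun Z ↦ ?_
  rw [L.g_curv_pair_symm h.unit, h.curv_xi]
  simp only [map_sub, map_smul, LinearMap.sub_apply, LinearMap.smul_apply, smul_eq_mul,
    L.g_symm Z X, L.g_symm Y X, L.g_symm ξ Z]
  ring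

lemma br_xi (h : L.IsKenmotsuField ξ) (X : 𝔛) : L.br ξ X = L.nab ξ X - X + L.g X ξ • ξ := by
  rw [br, h.nab_eq]; abel

/-- The Lie derivative along `ξ` of the connection. -/
lemma br_xi_nab (h : L.IsKenmotsuField ξ) (X Y : 𝔛) :
    L.br ξ (L.nab X Y) = L.nab (L.br ξ X) Y + L.nab X (L.br ξ Y)
    - (2 * (L.g X Y - L.g X ξ * L.g Y ξ)) • ξ := by
  have e := h.curv_xi_left X Y
  rw [curv_apply, sub_sub, sub_eq_iff_eq_add] at e
  rw [h.br_xi (L.nab X Y), e, h.br_xi Y]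
  simp only [map_sub, map_add, L.leibniz, h.D_eta, h.nab_eq]
  module

/-- The Lie derivative along `ξ` of the curvature. -/
lemma br_xi_curv (h : L.IsKenmotsuField ξ) (X Y Z : 𝔛) :
    L.br ξ (L.curv Y Z X) = L.curv Y Z (L.br ξ X)
    + L.curv (L.br ξ Y) Z X + L.curv Y (L.br ξ Z) X
    - (2 * (L.g Y Z - L.g Y ξ * L.g Z ξ)) • X + (2 * (L.g X Z - L.g X ξ * L.g Z ξ)) • Y := by
  have br_sub (U V W : 𝔛) : L.br U (V - W) = L.br U V - L.br U W := by
    simp only [br, map_sub, AddMonoidHom.sub_apply]; abel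
  rw [curv_apply, br_sub, br_sub, h.br_xi_nab, h.br_xi_nab, h.br_xi_nab, h.br_xi_nab, h.br_xi_nab,
    L.br_jacobi]
  simp only [curv_apply, map_add, map_sub, AddMonoidHom.add_apply,
    L.leibniz, h.nab_eq, Derivation.leibniz, L.D_two, h.D_eta, L.metric, smul_eq_mul]
  have e' : L.g (L.br X Y) Z = L.g (L.nab X Y) Z - L.g (L.nab Y X) Z := by simp [br]
  have e'' : L.g (L.br X Y) ξ = L.g (L.nab X Y) ξ - L.g (L.nab Y X) ξ := by simp [br]
  rw [e', e'', L.g_symm Y X, L.g_symm Y (L.nab X Z), L.g_symm X (L.nab Y Z)]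
  module

variable {m : ℕ}

lemma ricci_xi_right (h : L.IsKenmotsuField ξ) (hm : L.tr LinearMap.id = (m : A)) (Y : 𝔛) :
    L.tr (L.curv Y ξ) = (1 - m) * L.g Y ξ := by
  have e : L.curv Y ξ = (L.g.flip ξ).smulRight Y - L.g Y ξ • LinearMap.id := by
    ext X; simp [h.curv_xi]
  rw [e, map_sub, map_smul, L.tr_smulRight, hm, LinearMap.flip_apply, smul_eq_mul]
  ring

/-- The Lie derivative along `ξ` of the Ricci tensor. -/
lemma lie_xi_ricci (h : L.IsKenmotsuField ξ) (hm : L.tr LinearMap.id = (m : A)) (Y Z : 𝔛) :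
    L.lie ξ (fun Y Z ↦ L.tr (L.curv Y Z)) Y Z
    = 2 * (1 - m) * (L.g Y Z - L.g Y ξ * L.g Z ξ) := by
  have e := L.tr_eq_D_tr ξ (L.curv Y Z) (L.curv (L.br ξ Y) Z + L.curv Y (L.br ξ Z)
    - (2 * (L.g Y Z - L.g Y ξ * L.g Z ξ)) • LinearMap.id
    + (2 : A) • (L.g.flip Z - L.g Z ξ • L.g.flip ξ).smulRight Y) fun X ↦ by
      rw [h.br_xi_curv X Y Z]
      simp only [LinearMap.add_apply, LinearMap.sub_apply, LinearMap.smul_apply, LinearMap.id_apply,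
        LinearMap.smulRight_apply, LinearMap.flip_apply, smul_eq_mul]
      module
  simp only [map_add, map_sub, map_smul, L.tr_smulRight, hm, LinearMap.flip_apply, smul_eq_mul,
    LinearMap.sub_apply, LinearMap.smul_apply] at e
  rw [lie, ← e]
  ring

lemma lie_xi_metric (h : L.IsKenmotsuField ξ) (X Y : 𝔛) : L.lie ξ (fun X Y ↦ L.g X Y) X Y
    = 2 * (L.g X Y - L.g X ξ * L.g Y ξ) := by
  rw [lie, L.metric, h.br_xi, h.br_xi]
  simp only [map_sub, map_add, map_smul, LinearMap.sub_apply, LinearMap.add_apply,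
    LinearMap.smul_apply, smul_eq_mul, L.g_symm ξ Y]
  ring

end IsKenmotsuField

lemma br_swap (X Y : 𝔛) : L.br X Y = - L.br Y X := by
  simp only [br, neg_sub]

lemma lie_metric_eq (V X Y : 𝔛) : L.lie V (fun X Y ↦ L.g X Y) X Y
    = L.g (L.nab X V) Y + L.g X (L.nab Y V) := by
  rw [lie, L.metric]
  simp only [br, map_sub, LinearMap.sub_apply]
  ring

/-- The soliton equation `L_V g + 2 S + a g + k η ⊗ η = 0` with `η = g(·, ξ)`. -/
def IsSoliton (ξ V : 𝔛) (a k : A) : Prop :=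
  ∀ X Y, L.lie V (fun X Y ↦ L.g X Y) X Y + 2 * L.tr (L.curv X Y) + a * L.g X Y
    + k * (L.g X ξ * L.g Y ξ) = 0

namespace IsKenmotsuField

variable {L} {ξ : 𝔛}

lemma g_br_xi (h : L.IsKenmotsuField ξ) (X : 𝔛) : L.g (L.br ξ X) ξ = L.D ξ (L.g X ξ) := by
  rw [h.D_eta, h.br_xi]
  simp only [map_add, map_sub, map_smul, LinearMap.add_apply, LinearMap.sub_apply,
    LinearMap.smul_apply, smul_eq_mul, h.unit, L.g_symm ξ X]
  ring

/-- The Lie derivative along `V` of the closed form `η = g(·, ξ)` is `d(η(V))`. -/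
lemma lie_eta (h : L.IsKenmotsuField ξ) (V X : 𝔛) :
    L.D V (L.g X ξ) - L.g (L.br V X) ξ = L.D X (L.g V ξ) := by
  rw [h.D_eta, h.D_eta, br, L.g_symm X V]
  simp only [map_sub, LinearMap.sub_apply]
  ring

lemma lie_two_transverse (h : L.IsKenmotsuField ξ) (V X Y : 𝔛) :
    L.lie V (fun X Y ↦ 2 * (L.g X Y - L.g X ξ * L.g Y ξ)) X Y
      = 2 * (L.lie V (fun X Y ↦ L.g X Y) X Y
        - (L.D X (L.g V ξ) * L.g Y ξ + L.g X ξ * L.D Y (L.g V ξ))) := by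
  rw [← h.lie_eta V X, ← h.lie_eta V Y]
  simp only [lie, Derivation.leibniz, map_sub, smul_eq_mul, L.D_two]
  ring

section Soliton

variable {m : ℕ} {V : 𝔛} {a k : A}

lemma ricci_symm_of_soliton (hV : L.IsSoliton ξ V a k) (X Y : 𝔛) :
    L.tr (L.curv X Y) = L.tr (L.curv Y X) := by
  have e1 := hV X Y
  have e2 := hV Y X
  rw [lie_metric_eq] at e1 e2
  rw [L.g_symm (L.nab Y V) X, L.g_symm Y (L.nab X V), L.g_symm Y X] at e2
  exact eq_of_two_mul_eq (by linear_combination e1 - e2)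

lemma D_soliton_const (ha : ∀ X, L.D X a = 0) (hk : ∀ X, L.D X k = 0) (X : 𝔛) :
    L.D X (2 * (1 - m) + a + k) = 0 := by
  simp [ha, hk, L.D_two]

lemma g_br_of_soliton (h : L.IsKenmotsuField ξ) (hm : L.tr LinearMap.id = (m : A))
    (hV : L.IsSoliton ξ V a k) (X : 𝔛) :
    L.g (L.br V ξ) X = L.D X (L.g V ξ) + (2 * (1 - m) + a + k) * L.g X ξ := by
  have e := hV X ξ
  rw [h.ricci_xi_right hm, h.unit, lie, L.g_symm X (L.br V ξ)] at e
  linear_combination h.lie_eta V X - e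

lemma two_mul_g_br_of_soliton (h : L.IsKenmotsuField ξ) (hm : L.tr LinearMap.id = (m : A))
    (hV : L.IsSoliton ξ V a k) : 2 * L.g (L.br V ξ) ξ = 2 * (1 - m) + a + k := by
  have e := hV ξ ξ
  rw [h.ricci_xi_right hm, h.unit, lie, h.unit, L.g_symm ξ (L.br V ξ), Derivation.map_one_eq_zero]
    at e
  linear_combination -e

lemma D_g_br_of_soliton (h : L.IsKenmotsuField ξ) (hm : L.tr LinearMap.id = (m : A))
    (ha : ∀ X, L.D X a = 0) (hk : ∀ X, L.D X k = 0) (hV : L.IsSoliton ξ V a k) (X : 𝔛) :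
    L.D X (L.g (L.br V ξ) ξ) = 0 := by
  have e := congrArg (L.D X) (h.two_mul_g_br_of_soliton hm hV)
  rw [Derivation.leibniz, D_soliton_const ha hk, L.D_two, smul_zero, add_zero, smul_eq_mul] at e
  exact eq_of_two_mul_eq (by linear_combination e)

lemma D_D_xi_of_soliton (h : L.IsKenmotsuField ξ) (hm : L.tr LinearMap.id = (m : A))
    (ha : ∀ X, L.D X a = 0) (hk : ∀ X, L.D X k = 0) (hV : L.IsSoliton ξ V a k) (X : 𝔛) :
    L.D X (L.D ξ (L.g V ξ)) = 0 := by
  have e := h.g_br_of_soliton hm hV ξ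
  rw [h.unit, mul_one, ← sub_eq_iff_eq_add] at e
  rw [← e, map_sub, h.D_g_br_of_soliton hm ha hk hV, D_soliton_const ha hk, sub_zero]

lemma g_br_xi_br_of_soliton (h : L.IsKenmotsuField ξ) (hm : L.tr LinearMap.id = (m : A))
    (ha : ∀ X, L.D X a = 0) (hk : ∀ X, L.D X k = 0) (hV : L.IsSoliton ξ V a k) (X : 𝔛) :
    L.g (L.br ξ (L.br V ξ)) X
    = -2 * L.g (L.br V ξ) X + (2 * (1 - m) + a + k) * L.g X ξ := by
  have hc := D_soliton_const (m := m) ha hk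
  have hW := h.g_br_of_soliton hm hV
  have hWξ := h.two_mul_g_br_of_soliton hm hV
  have hf' := h.D_D_xi_of_soliton hm ha hk hV X
  generalize (2 * (1 - m) + a + k : A) = c at hc hW hWξ ⊢
  have e1 := L.metric ξ (L.br V ξ) X
  rw [hW X, hW (L.nab ξ X), map_add, Derivation.leibniz, hc, h.D_eta ξ X, h.unit,
    L.g_symm ξ X] at e1
  have e2 := L.D_br_apply h.unit ξ X (L.g V ξ)
  rw [hf', br, h.nab_eq] at e2
  simp only [map_sub, map_smul, Derivation.sub_apply, Derivation.smul_apply, smul_eq_mul] at e1 e2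
  rw [h.br_xi]
  simp only [map_sub, map_add, map_smul, LinearMap.sub_apply, LinearMap.add_apply,
    LinearMap.smul_apply, smul_eq_mul]
  have e3 : L.g (L.br V ξ) ξ = L.D ξ (L.g V ξ) + c := by simpa [h.unit] using hW ξ
  rw [L.g_symm ξ X]
  linear_combination -e1 - e2 + hW X - L.g X ξ * e3 + L.g X ξ * hWξ

lemma lie_xi_lie_metric_of_soliton (h : L.IsKenmotsuField ξ) (hm : L.tr LinearMap.id = (m : A))
    (ha : ∀ X, L.D X a = 0) (hk : ∀ X, L.D X k = 0) (hV : L.IsSoliton ξ V a k) (X Y : 𝔛) :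
    L.lie ξ (L.lie V fun X Y ↦ L.g X Y) X Y
    = -2 * (2 * (1 - m) + a) * (L.g X Y - L.g X ξ * L.g Y ξ) := by
  have e : (L.lie V fun X Y ↦ L.g X Y)
      = fun X Y ↦ -(2 * L.tr (L.curv X Y) + a * L.g X Y + k * (L.g X ξ * L.g Y ξ)) := by
    ext X Y; linear_combination hV X Y
  have e1 := h.lie_xi_ricci hm X Y
  have e2 := h.lie_xi_metric X Y
  rw [e]
  simp only [lie, map_neg, map_add, Derivation.leibniz, smul_eq_mul, L.D_two, ha, hk, h.g_br_xi]
    at e1 e2 ⊢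
  linear_combination -2 * e1 - a * e2

lemma lie_br_metric_of_soliton (h : L.IsKenmotsuField ξ) (hm : L.tr LinearMap.id = (m : A))
    (ha : ∀ X, L.D X a = 0) (hk : ∀ X, L.D X k = 0) (hV : L.IsSoliton ξ V a k) :
    (L.lie (L.br V ξ) fun X Y ↦ L.g X Y) = fun X Y ↦
    2 * L.lie V (fun X Y ↦ L.g X Y) X Y
      - 2 * (L.D X (L.g V ξ) * L.g Y ξ + L.g X ξ * L.D Y (L.g V ξ))
      + (2 * (1 - m) + a) * (2 * (L.g X Y - L.g X ξ * L.g Y ξ)) := by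
  ext X Y
  have e := L.lie_lie_metric h.unit ξ V X Y
  have e1 : L.lie ξ (fun X Y ↦ L.g X Y) = fun X Y ↦ 2 * (L.g X Y - L.g X ξ * L.g Y ξ) := by
    ext X Y; exact h.lie_xi_metric X Y
  have e3 : L.lie (L.br ξ V) (fun X Y ↦ L.g X Y) X Y
      = - L.lie (L.br V ξ) (fun X Y ↦ L.g X Y) X Y := by
    have br_neg (U W : 𝔛) : L.br (-U) W = - L.br U W := by
      rw [← neg_one_smul A, br_swap, br_smul_right, map_neg, Derivation.map_one_eq_zero,
        L.br_swap U W]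
      module
    rw [L.br_swap ξ V]
    simp only [lie, br_neg, map_neg, LinearMap.neg_apply, Derivation.neg_apply]
    ring
  rw [e1, h.lie_two_transverse, h.lie_xi_lie_metric_of_soliton hm ha hk hV, e3] at e
  linear_combination e

lemma lie_xi_lie_br_metric_of_soliton (h : L.IsKenmotsuField ξ)
    (hm : L.tr LinearMap.id = (m : A)) (ha : ∀ X, L.D X a = 0) (hk : ∀ X, L.D X k = 0)
    (hV : L.IsSoliton ξ V a k) (X Y : 𝔛) :
    L.lie ξ (L.lie (L.br V ξ) fun X Y ↦ L.g X Y) X Y = 0 := by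
  have e1 := h.lie_xi_lie_metric_of_soliton hm ha hk hV X Y
  have e2 := h.lie_two_transverse ξ X Y
  have e3 (X : 𝔛) : L.D (L.br ξ X) (L.g V ξ) = L.D ξ (L.D X (L.g V ξ)) := by
    rw [L.D_br_apply h.unit, h.D_D_xi_of_soliton hm ha hk hV, sub_zero]
  rw [h.lie_xi_metric, h.unit, Derivation.map_one_eq_zero, Derivation.map_one_eq_zero] at e2
  rw [h.lie_br_metric_of_soliton hm ha hk hV, lie]
  rw [lie] at e1 e2
  simp only [map_add, map_sub, Derivation.leibniz, smul_eq_mul, L.D_two, ha, h.g_br_xi, e3,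
    Derivation.map_one_eq_zero, Derivation.map_natCast] at e1 e2 ⊢
  linear_combination 2 * e1 + (2 * (1 - m) + a) * e2

lemma soliton_const_mul_transverse (h : L.IsKenmotsuField ξ) (hm : L.tr LinearMap.id = (m : A))
    (ha : ∀ X, L.D X a = 0) (hk : ∀ X, L.D X k = 0) (hV : L.IsSoliton ξ V a k) (X Y : 𝔛) :
    (2 * (1 - m) + a + k) * (L.g X Y - L.g X ξ * L.g Y ξ) = 0 := by
  have hc := D_soliton_const (m := m) ha hk
  have hU : L.br ξ (L.br V ξ)
      = (-2 : A) • L.br V ξ + (2 * (1 - m) + a + k) • ξ := L.g_ext fun X ↦ by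
    rw [h.g_br_xi_br_of_soliton hm ha hk hV, map_add, map_smul, map_smul, LinearMap.add_apply,
      LinearMap.smul_apply, LinearMap.smul_apply, L.g_symm ξ X, smul_eq_mul, smul_eq_mul]
  have e := L.lie_lie_metric h.unit ξ (L.br V ξ) X Y
  have e1 : L.lie ξ (fun X Y ↦ L.g X Y) = fun X Y ↦ 2 * (L.g X Y - L.g X ξ * L.g Y ξ) := by
    ext X Y; exact h.lie_xi_metric X Y
  rw [h.lie_xi_lie_br_metric_of_soliton hm ha hk hV, e1, h.lie_two_transverse,
    h.D_g_br_of_soliton hm ha hk hV, h.D_g_br_of_soliton hm ha hk hV, hU, lie_metric_eq,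
    lie_metric_eq] at e
  have e2 := h.lie_xi_metric X Y
  rw [lie_metric_eq] at e2
  simp only [map_add, L.leibniz, map_neg, L.D_two, hc, LinearMap.add_apply, LinearMap.smul_apply,
    map_smul, smul_eq_mul, neg_zero] at e
  refine eq_of_two_mul_eq ?_
  linear_combination -e - (2 * (1 - m) + a + k) * e2

theorem lie_ricci_xi_xi_eq_zero (h : L.IsKenmotsuField ξ) (hm : L.tr LinearMap.id = (m : A))
    (ha : ∀ X, L.D X a = 0) (hk : ∀ X, L.D X k = 0) (hV : L.IsSoliton ξ V a k) :
    L.lie V (fun Y Z ↦ L.tr (L.curv Y Z)) ξ ξ = 0 := by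
  have e (X : 𝔛) : (2 * (1 - m) + a + k) • (X - L.g X ξ • ξ) = 0 := L.g_nondeg _ fun Y ↦ by
    have := h.soliton_const_mul_transverse hm ha hk hV X Y
    simpa [L.g_symm ξ Y] using this
  have e1 : L.tr ((2 * (1 - m) + a + k) • (LinearMap.id - (L.g.flip ξ).smulRight ξ)) = 0 := by
    rw [show (2 * (1 - m) + a + k) • (LinearMap.id - (L.g.flip ξ).smulRight ξ) = 0 from
      LinearMap.ext fun X ↦ by simpa using e X, map_zero]
  rw [map_smul, map_sub, hm, L.tr_smulRight, LinearMap.flip_apply, h.unit, smul_eq_mul] at e1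
  rw [lie, ricci_symm_of_soliton hV ξ (L.br V ξ), h.ricci_xi_right hm, h.ricci_xi_right hm, h.unit,
    mul_one, map_sub, Derivation.map_one_eq_zero, Derivation.map_natCast]
  linear_combination e1 + (m - 1) * h.two_mul_g_br_of_soliton hm hV

end Soliton

end IsKenmotsuField

end RiemannianFieldAlgebra

noncomputable section

section SmoothFields

variable {E : Type*} [NormedAddCommGroup E] [NormedSpace ℝ E]
  {H : Type*} [TopologicalSpace H] (I : ModelWithCorners ℝ E H)
  (M : Type*) [TopologicalSpace M] [ChartedSpace H M]

/-- The algebra of smooth real functions on `M`. -/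
def smoothFunctions : Subalgebra ℝ (M → ℝ) where
  carrier := {f | ContMDiff I 𝓘(ℝ) ∞ f}
  mul_mem' hf hg := ContMDiff.mul hf hg
  add_mem' hf hg := ContMDiff.add hf hg
  algebraMap_mem' _ := contMDiff_const

variable {I M} in
lemma smoothFunctions_mdifferentiableAt (f : smoothFunctions I M) (x : M) :
    MDifferentiableAt I 𝓘(ℝ) f.1 x :=
  (f.2 x).mdifferentiableAt (by simp)

variable [IsManifold I ∞ M]

/-- The module of smooth vector fields on `M`. -/
def smoothFields : Submodule (smoothFunctions I M) (Π x : M, TangentSpace I x) where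
  carrier := {X | IsSmoothField X}
  add_mem' hX hY := ContMDiff.add_section hX hY
  zero_mem' := contMDiff_zeroSection ℝ (TangentSpace I : M → Type _)
  smul_mem' f _ hX := ContMDiff.smul_section f.2 hX

instance : AddCommGroup (smoothFields I M) := (smoothFields I M).addCommGroup

instance : Module (smoothFunctions I M) (smoothFields I M) := (smoothFields I M).module

instance : SMul (smoothFunctions I M) (smoothFields I M) := Module.toDistribMulAction.toSMul

instance : Module (smoothFunctions I M) (Module.End (smoothFunctions I M) (smoothFields I M)) :=
  LinearMap.module

instance : SMul (smoothFunctions I M) (Module.End (smoothFunctions I M) (smoothFields I M)) :=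
  Module.toDistribMulAction.toSMul

variable {I M}

lemma IsSmoothField.mdifferentiableAt {X : Π x : M, TangentSpace I x} (hX : IsSmoothField X)
    (x : M) : MDifferentiableAt I (I.prod 𝓘(ℝ, E))
      (fun x ↦ (⟨x, X x⟩ : TotalSpace E (TangentSpace I : M → Type _))) x :=
  (hX x).mdifferentiableAt (by simp)

lemma IsSmoothField.contMDiff_mvfderiv {X : Π x : M, TangentSpace I x} (hX : IsSmoothField X)
    {f : M → ℝ} (hf : ContMDiff I 𝓘(ℝ) ∞ f) :
    ContMDiff I 𝓘(ℝ) ∞ fun x ↦ mvfderiv I f x (X x) :=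
  (contMDiff_snd_tangentBundle_modelSpace ℝ 𝓘(ℝ)).comp
    ((hf.contMDiff_tangentMap (m := ∞) (by simp)).comp hX)

/-- The derivative of smooth functions along a smooth vector field. -/
def fieldDeriv (X : smoothFields I M) :
    Derivation ℝ (smoothFunctions I M) (smoothFunctions I M) :=
  Derivation.mk'
    { toFun := fun f ↦ ⟨fun x ↦ mvfderiv I f.1 x (X.1 x), IsSmoothField.contMDiff_mvfderiv X.2 f.2⟩
      map_add' := fun f f' ↦ Subtype.ext <| funext fun x ↦ by
        have := mvfderiv_add (smoothFunctions_mdifferentiableAt f x)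
          (smoothFunctions_mdifferentiableAt f' x)
        exact congrArg (fun l ↦ l (X.1 x)) this
      map_smul' := fun c f ↦ Subtype.ext <| funext fun x ↦ by
        have := mvfderiv_smul (mdifferentiableAt_const (c := c))
          (smoothFunctions_mdifferentiableAt f x)
        rw [mvfderiv_const, ContinuousLinearMap.zero_smulRight, add_zero] at this
        exact congrArg (fun l ↦ l (X.1 x)) this }
    fun f f' ↦ Subtype.ext <| funext fun x ↦ by
      have := mvfderiv_mul (smoothFunctions_mdifferentiableAt f x)
          (smoothFunctions_mdifferentiableAt f' x)
      simpa using congrArg (fun l ↦ l (X.1 x)) this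

variable (I M) in
/-- The action of smooth vector fields on smooth functions. -/
def fieldDerivation : smoothFields I M →ₗ[smoothFunctions I M]
    Derivation ℝ (smoothFunctions I M) (smoothFunctions I M) where
  toFun := fieldDeriv
  map_add' X Y := Derivation.ext fun f ↦ Subtype.ext <| funext fun x ↦
    map_add (mvfderiv I f.1 x) (X.1 x) (Y.1 x)
  map_smul' h X := Derivation.ext fun f ↦ Subtype.ext <| funext fun x ↦
    map_smul (mvfderiv I f.1 x) (h.1 x) (X.1 x)

section LocalFrame

variable [FiniteDimensional ℝ E] [T2Space M]

/-- Near every point the identity of the module of smooth vector fields has finite rank. -/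
lemma exists_cutoff_eq_sum (x : M) : ∃ (χ : smoothFunctions I M) (k : ℕ)
    (F : Fin k → smoothFields I M)
    (θ : Fin k → smoothFields I M →ₗ[smoothFunctions I M] smoothFunctions I M),
    (∀ᶠ y in nhds x, χ.1 y = 1) ∧ (∀ i X y, X.1 y = 0 → (θ i X).1 y = 0) ∧
      ∀ X, χ • X = ∑ i, θ i X • F i := by
  let b := Module.finBasis ℝ E
  let e := trivializationAt E (TangentSpace I : M → Type _) x
  have he : e.baseSet = (chartAt H x).source := TangentBundle.trivializationAt_baseSet x
  let f : SmoothBumpFunction I x := Classical.arbitrary _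
  have hf : tsupport f ⊆ e.baseSet := he ▸ f.tsupport_subset_chartAt_source
  let χ : smoothFunctions I M := ⟨f, f.contMDiff⟩
  let F (i : Fin (Module.finrank ℝ E)) : smoothFields I M :=
    ⟨(f : M → ℝ) • e.localFrame b i, ContMDiffOn.smul_section_of_tsupport f.contMDiff.contMDiffOn
      e.open_baseSet hf (e.contMDiffOn_localFrame_baseSet (I := I) ∞ b i)⟩
  let θ (i : Fin (Module.finrank ℝ E)) :
      smoothFields I M →ₗ[smoothFunctions I M] smoothFunctions I M :=
    { toFun := fun X ↦ ⟨fun y ↦ f y • e.localFrameCoeff I b i y (X.1 y), f.contMDiff_smul <| he ▸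
        contMDiffOn_baseSet_localFrameCoeff b (ContMDiff.contMDiffOn X.2) i⟩
      map_add' := fun X Y ↦ Subtype.ext <| funext fun y ↦ by
        have := map_add (e.localFrameCoeff I b i y) (X.1 y) (Y.1 y)
        simp [this, mul_add]
      map_smul' := fun h X ↦ Subtype.ext <| funext fun y ↦ by
        have := map_smul (e.localFrameCoeff I b i y) (h.1 y) (X.1 y)
        exact (congrArg (f y * ·) this).trans (mul_left_comm _ _ _) }
  refine ⟨χ * χ, _, F, θ, ?_, fun i X y hX ↦ ?_, fun X ↦ Subtype.ext <| funext fun y ↦ ?_⟩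
  · filter_upwards [f.eventuallyEq_one] with y hy
    simp [χ, hy]
  · change f y * e.localFrameCoeff I b i y (X.1 y) = 0
    rw [hX, map_zero, mul_zero]
  · have hsum : (∑ i, θ i X • F i).1 y = ∑ i, (θ i X).1 y • (F i).1 y := by
      rw [Submodule.coe_sum, Finset.sum_apply]; rfl
    change (f y * f y) • X.1 y = _
    rw [hsum]
    by_cases hy : y ∈ e.baseSet
    · conv_lhs => rw [e.eq_sum_localFrameCoeff_smul (I := I) (b := b) (s := X.1) hy]
      rw [Finset.smul_sum]
      refine Finset.sum_congr rfl fun i _ ↦ ?_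
      change _ = (f y * e.localFrameCoeff I b i y (X.1 y)) • (f y • e.localFrame b i y)
      module
    · have : f y = 0 := image_eq_zero_of_notMem_tsupport fun h ↦ hy (hf h)
      rw [this, mul_zero, zero_smul]
      refine (Finset.sum_eq_zero fun i _ ↦ ?_).symm
      change (f y * e.localFrameCoeff I b i y (X.1 y)) • _ = _
      rw [this, zero_mul, zero_smul]

/-- Every tangent vector is the value of a smooth vector field. -/
lemma exists_smoothField_eq {x : M} (v : TangentSpace I x) : ∃ X : smoothFields I M, X.1 x = v := by
  obtain ⟨s, hs, hsv⟩ := exists_contMDiffOn_extend (k := ∞) I E v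
  obtain ⟨u, hus, hu, hxu⟩ := mem_nhds_iff.1 hs
  obtain ⟨f, hf⟩ := (SmoothBumpFunction.nhds_basis_tsupport (I := I) x).mem_iff.1 (hu.mem_nhds hxu)
  refine ⟨⟨(f : M → ℝ) • extend E v, ContMDiffOn.smul_section_of_tsupport f.contMDiff.contMDiffOn
    hu hf.2 (hsv.mono hus)⟩, ?_⟩
  change f x • extend E v x = v
  rw [f.eq_one, extend_apply_self, one_smul]

lemma smoothFields_form_apply_eq_zero
    (α : smoothFields I M →ₗ[smoothFunctions I M] smoothFunctions I M)
    {x : M} {X : smoothFields I M} (hX : X.1 x = 0) : (α X).1 x = 0 := by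
  obtain ⟨χ, k, F, θ, hχ, hθ, h⟩ := exists_cutoff_eq_sum (I := I) x
  have h1 := congrArg (fun Y ↦ (α Y).1 x) (h X)
  simp only [map_sum, map_smul, AddSubmonoidClass.coe_finsetSum, Finset.sum_apply] at h1
  calc (α X).1 x = χ.1 x * (α X).1 x := by rw [hχ.self_of_nhds, one_mul]
    _ = _ := h1
    _ = 0 := Finset.sum_eq_zero fun i _ ↦ by
      change (θ i X).1 x * (α (F i)).1 x = 0
      rw [hθ i X x hX, zero_mul]

/-- A smooth vector field with a prescribed value at a point. -/
def fieldThrough {x : M} (v : TangentSpace I x) : smoothFields I M :=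
  (exists_smoothField_eq v).choose

lemma fieldThrough_apply {x : M} (v : TangentSpace I x) : (fieldThrough v).1 x = v :=
  (exists_smoothField_eq v).choose_spec

end LocalFrame

end SmoothFields

section RiemannianFields

variable {E : Type*} [NormedAddCommGroup E] [NormedSpace ℝ E] [FiniteDimensional ℝ E]
  {H : Type*} [TopologicalSpace H] {I : ModelWithCorners ℝ E H}
  {M : Type*} [TopologicalSpace M] [ChartedSpace H M] [IsManifold I ∞ M]
  [RiemannianBundle (fun x : M ↦ TangentSpace I x)]

instance (x : M) : FiniteDimensional ℝ (TangentSpace I x) :=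
  inferInstanceAs (FiniteDimensional ℝ E)

section Trace

variable [T2Space M]

/-- The pointwise trace of an endomorphism of the module of smooth vector fields. -/
def traceFun (P : Module.End (smoothFunctions I M) (smoothFields I M)) (x : M) : ℝ :=
  ∑ i, inner ℝ ((P (fieldThrough (stdOrthonormalBasis ℝ (TangentSpace I x) i))).1 x)
    (stdOrthonormalBasis ℝ (TangentSpace I x) i)

lemma sum_form_mul_inner (α : smoothFields I M →ₗ[smoothFunctions I M] smoothFunctions I M)
    (Y : smoothFields I M) (x : M) :
    ∑ i, (α (fieldThrough (stdOrthonormalBasis ℝ (TangentSpace I x) i))).1 x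
      * inner ℝ (Y.1 x) (stdOrthonormalBasis ℝ (TangentSpace I x) i) = (α Y).1 x := by
  let c (i) : smoothFunctions I M :=
    algebraMap ℝ _ (inner ℝ (Y.1 x) (stdOrthonormalBasis ℝ (TangentSpace I x) i))
  let Z : smoothFields I M :=
    ∑ i, c i • fieldThrough (stdOrthonormalBasis ℝ (TangentSpace I x) i)
  have hZ : Z.1 x = Y.1 x := by
    conv_rhs => rw [← (stdOrthonormalBasis ℝ (TangentSpace I x)).sum_repr' (Y.1 x)]
    rw [Submodule.coe_sum, Finset.sum_apply]
    refine Finset.sum_congr rfl fun i _ ↦ ?_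
    rw [real_inner_comm]
    exact congrArg _ (fieldThrough_apply _)
  have h0 : (α (Y - Z)).1 x = 0 := smoothFields_form_apply_eq_zero α (sub_eq_zero.2 hZ.symm)
  rw [map_sub] at h0
  rw [sub_eq_zero.1 h0, map_sum, AddSubmonoidClass.coe_finsetSum, Finset.sum_apply]
  refine Finset.sum_congr rfl fun i _ ↦ ?_
  rw [map_smul]
  exact mul_comm _ _

lemma traceFun_smulRight (α : smoothFields I M →ₗ[smoothFunctions I M] smoothFunctions I M)
    (Y : smoothFields I M) : traceFun (α.smulRight Y) = (α Y).1 := by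
  ext x
  rw [← sum_form_mul_inner]
  exact Finset.sum_congr rfl fun i _ ↦ real_inner_smul_left _ _ _

lemma traceFun_add (P Q : Module.End (smoothFunctions I M) (smoothFields I M)) :
    traceFun (P + Q) = traceFun P + traceFun Q := by
  ext x
  rw [Pi.add_apply, traceFun, traceFun, traceFun, ← Finset.sum_add_distrib]
  exact Finset.sum_congr rfl fun i _ ↦ inner_add_left _ _ _

lemma traceFun_smul (f : smoothFunctions I M)
    (P : Module.End (smoothFunctions I M) (smoothFields I M)) :
    traceFun (f • P) = f.1 * traceFun P := by
  ext x
  rw [Pi.mul_apply, traceFun, traceFun, Finset.mul_sum]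
  exact Finset.sum_congr rfl fun i _ ↦ real_inner_smul_left _ _ _

lemma traceFun_sum {k : ℕ} (P : Fin k → Module.End (smoothFunctions I M) (smoothFields I M)) :
    traceFun (∑ i, P i) = ∑ i, traceFun (P i) :=
  map_sum (AddMonoidHom.mk' (traceFun (I := I) (M := M)) traceFun_add) P Finset.univ

lemma contMDiff_traceFun (P : Module.End (smoothFunctions I M) (smoothFields I M)) :
    ContMDiff I 𝓘(ℝ) ∞ (traceFun P) := by
  intro x
  obtain ⟨χ, k, F, θ, hχ, -, h⟩ := exists_cutoff_eq_sum (I := I) x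
  have hP : χ • P = ∑ i, (θ i).smulRight (P (F i)) := LinearMap.ext fun X ↦ by
    rw [LinearMap.smul_apply, ← map_smul, h, map_sum, LinearMap.sum_apply]
    exact Finset.sum_congr rfl fun i _ ↦ map_smul _ _ _
  have h1 := congrArg traceFun hP
  rw [traceFun_smul, traceFun_sum] at h1
  simp only [traceFun_smulRight] at h1
  have h2 : (∑ i, θ i (P (F i)) : smoothFunctions I M).1 = χ.1 * traceFun P := by
    rw [h1, AddSubmonoidClass.coe_finsetSum]
  refine ((∑ i, θ i (P (F i)) : smoothFunctions I M).2 x).congr_of_eventuallyEq ?_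
  filter_upwards [hχ] with y hy
  rw [h2, Pi.mul_apply, hy, one_mul]

variable (I M) in
/-- The pointwise trace of endomorphisms of the module of smooth vector fields. -/
def fieldTrace : Module.End (smoothFunctions I M) (smoothFields I M) →ₗ[smoothFunctions I M]
    smoothFunctions I M where
  toFun P := ⟨traceFun P, contMDiff_traceFun P⟩
  map_add' P Q := Subtype.ext (traceFun_add P Q)
  map_smul' f P := Subtype.ext (traceFun_smul f P)

lemma fieldTrace_id : fieldTrace I M LinearMap.id = (Module.finrank ℝ E : smoothFunctions I M) := by
  refine Subtype.ext <| funext fun x ↦ ?_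
  change ∑ i, inner ℝ ((fieldThrough (stdOrthonormalBasis ℝ (TangentSpace I x) i)).1 x)
    (stdOrthonormalBasis ℝ (TangentSpace I x) i) = _
  simp only [fieldThrough_apply]
  simp
  rfl

end Trace

end RiemannianFields

section LeviCivita

variable {E : Type*} [NormedAddCommGroup E] [NormedSpace ℝ E]
  {H : Type*} [TopologicalSpace H] {I : ModelWithCorners ℝ E H}
  {M : Type*} [TopologicalSpace M] [ChartedSpace H M] [IsManifold I ∞ M]
  {nabla : CovariantDerivative I E (TangentSpace I : M → Type _)}

lemma IsSmoothField.contMDiff_nabla (hn : nabla.ContMDiffCovariantDerivative ∞)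
    {Y : Π x : M, TangentSpace I x} (hY : IsSmoothField Y) :
    ContMDiff I (I.prod 𝓘(ℝ, E →L[ℝ] E)) ∞ (fun x ↦ (⟨x, nabla Y x⟩ :
      TotalSpace (E →L[ℝ] E) (fun x : M ↦ TangentSpace I x →L[ℝ] TangentSpace I x))) :=
  contMDiffOn_univ.1 (hn.contMDiff.contMDiff (ContMDiff.contMDiffOn hY))

lemma IsSmoothField.covDeriv (hn : nabla.ContMDiffCovariantDerivative ∞)
    {X Y : Π x : M, TangentSpace I x} (hX : IsSmoothField X) (hY : IsSmoothField Y) :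
    IsSmoothField (covDeriv nabla X Y) :=
  ContMDiff.clm_bundle_apply (hY.contMDiff_nabla hn) hX

variable [FiniteDimensional ℝ E]

lemma covDeriv_sub_eq_mlieBracket (ht : nabla.torsion = 0) {X Y : Π x : M, TangentSpace I x}
    (hX : IsSmoothField X) (hY : IsSmoothField Y) :
    covDeriv nabla X Y - covDeriv nabla Y X = mlieBracket I X Y :=
  funext fun x ↦ nabla.torsion_eq_zero_iff.1 ht (hX.mdifferentiableAt x) (hY.mdifferentiableAt x)

/-- The covariant derivative on smooth vector fields. -/
def fieldConnection (hn : nabla.ContMDiffCovariantDerivative ∞) :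
    smoothFields I M →ₗ[smoothFunctions I M] smoothFields I M →+ smoothFields I M where
  toFun X := AddMonoidHom.mk' (fun Y ↦ ⟨covDeriv nabla X.1 Y.1, IsSmoothField.covDeriv hn X.2 Y.2⟩)
    fun Y Z ↦ Subtype.ext <| funext fun x ↦ congrArg (fun l ↦ l (X.1 x)) <|
      nabla.isCovariantDerivativeOn.add (s := Set.univ) (IsSmoothField.mdifferentiableAt Y.2 x)
        (IsSmoothField.mdifferentiableAt Z.2 x)
  map_add' X Y := AddMonoidHom.ext fun Z ↦ Subtype.ext <| funext fun x ↦
    map_add (nabla Z.1 x) (X.1 x) (Y.1 x)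
  map_smul' f X := AddMonoidHom.ext fun Z ↦ Subtype.ext <| funext fun x ↦
    map_smul (nabla Z.1 x) (f.1 x) (X.1 x)

/-- The value at `x` of the curvature `R(X, Y)Z` depends on `X` only through `X x`. -/
lemma curvature_congr (hn : nabla.ContMDiffCovariantDerivative ∞)
    {X X' Y Z : Π x : M, TangentSpace I x} {x : M}
    (hX : MDifferentiableAt I (I.prod 𝓘(ℝ, E))
      (fun x ↦ (⟨x, X x⟩ : TotalSpace E (TangentSpace I : M → Type _))) x)
    (hX' : MDifferentiableAt I (I.prod 𝓘(ℝ, E))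
      (fun x ↦ (⟨x, X' x⟩ : TotalSpace E (TangentSpace I : M → Type _))) x)
    (hZ : IsSmoothField Z) (h : X x = X' x) :
    curvature nabla X Y Z x = curvature nabla X' Y Z x := by
  have hd {X : Π x : M, TangentSpace I x} (hX : MDifferentiableAt I (I.prod 𝓘(ℝ, E))
      (fun x ↦ (⟨x, X x⟩ : TotalSpace E (TangentSpace I : M → Type _))) x) :
      MDifferentiableAt I (I.prod 𝓘(ℝ, E)) (fun x ↦ (⟨x, covDeriv nabla X Z x⟩ :
        TotalSpace E (TangentSpace I : M → Type _))) x :=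
    MDifferentiableAt.clm_bundle_apply
      ((hZ.contMDiff_nabla hn x).mdifferentiableAt (by simp)) hX
  refine TensorialAt.pointwise (I := I) (F := E) (Φ := fun X ↦ curvature nabla X Y Z x)
    ⟨fun {f X} hf hX ↦ ?_, fun {X X'} hX hX' ↦ ?_⟩ hX hX' h
  · have e1 := nabla.isCovariantDerivativeOn.leibniz (s := Set.univ) (hd hX) hf
    have e2 := mlieBracket_smul_left (W := Y) hf hX
    have e3 : covDeriv nabla (f • X) Z = f • covDeriv nabla X Z :=
      funext fun y ↦ map_smul (nabla Z y) (f y) (X y)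
    simp only [curvature, Pi.sub_apply, e3]
    simp only [covDeriv, e2, map_add, map_smul, Pi.smul_apply']
    change _ - nabla (f • covDeriv nabla X Z) x (Y x) - _ = _
    rw [e1]
    simp only [add_apply, smul_apply,
      ContinuousLinearMap.smulRight_apply, covDeriv]
    module
  · have e1 := nabla.isCovariantDerivativeOn.add (s := Set.univ) (hd hX) (hd hX')
    have e2 := mlieBracket_add_left (W := Y) hX hX'
    have e3 : covDeriv nabla (X + X') Z = covDeriv nabla X Z + covDeriv nabla X' Z :=
      funext fun y ↦ map_add (nabla Z y) (X y) (X' y)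
    simp only [curvature, Pi.sub_apply, e3]
    simp only [covDeriv, e2, map_add, Pi.add_apply]
    change _ - nabla (covDeriv nabla X Z + covDeriv nabla X' Z) x (Y x) - _ = _
    rw [e1]
    simp only [add_apply]
    module

variable [RiemannianBundle (fun x : M ↦ TangentSpace I x)]

section Metric

variable [IsContMDiffRiemannianBundle I ∞ E (fun x : M ↦ TangentSpace I x)]

variable (I M) in
/-- The metric on smooth vector fields. -/
def fieldMetric : smoothFields I M →ₗ[smoothFunctions I M] smoothFields I M →ₗ[smoothFunctions I M]
    smoothFunctions I M :=
  LinearMap.mk₂ _ (fun X Y ↦ ⟨metricTensor X.1 Y.1, ContMDiff.inner_bundle X.2 Y.2⟩)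
    (fun _ _ _ ↦ Subtype.ext <| funext fun _ ↦ inner_add_left _ _ _)
    (fun _ _ _ ↦ Subtype.ext <| funext fun _ ↦ real_inner_smul_left _ _ _)
    (fun _ _ _ ↦ Subtype.ext <| funext fun _ ↦ inner_add_right _ _ _)
    (fun _ _ _ ↦ Subtype.ext <| funext fun _ ↦ real_inner_smul_right _ _ _)

variable [T2Space M]

/-- The algebraic structure on the smooth vector fields of a Riemannian manifold. -/
def IsLeviCivita.fieldAlgebra (h : IsLeviCivita nabla) :
    RiemannianFieldAlgebra (smoothFunctions I M) (smoothFields I M) where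
  D := fieldDerivation I M
  nab := fieldConnection h.smooth
  g := fieldMetric I M
  tr := fieldTrace I M
  leibniz X f Y := Subtype.ext <| funext fun x ↦ by
    have := nabla.isCovariantDerivativeOn.leibniz (s := Set.univ)
      (IsSmoothField.mdifferentiableAt Y.2 x) (smoothFunctions_mdifferentiableAt f x)
    exact (congrArg (fun l ↦ l (X.1 x)) this).trans (add_comm _ _)
  metric X Y Z := Subtype.ext <| funext fun x ↦ h.metric X.1 Y.1 Z.1 X.2 Y.2 Z.2 x
  g_symm X Y := Subtype.ext <| funext fun _ ↦ real_inner_comm _ _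
  g_nondeg X hX := Subtype.ext <| funext fun x ↦
    inner_self_eq_zero.1 (congrArg (fun f ↦ f.1 x) (hX X))
  jacobi X Y Z := Subtype.ext <| by
    have hs {X Y : Π x : M, TangentSpace I x} (hX : IsSmoothField X) (hY : IsSmoothField Y) :
        IsSmoothField (covDeriv nabla X Y - covDeriv nabla Y X) :=
      ContMDiff.sub_section (hX.covDeriv h.smooth hY) (hY.covDeriv h.smooth hX)
    have hb {X Y : Π x : M, TangentSpace I x} (hX : IsSmoothField X) (hY : IsSmoothField Y) :=
      covDeriv_sub_eq_mlieBracket h.torsion_eq_zero hX hY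
    have hle : minSmoothness ℝ 2 ≤ (∞ : WithTop ℕ∞) := by
      rw [minSmoothness_of_isRCLikeNormedField]; exact ENat.LEInfty.out
    have : IsManifold I (minSmoothness ℝ 3) M := by
      rw [minSmoothness_of_isRCLikeNormedField]; infer_instance
    have e := leibniz_identity_mlieBracket (I := I) (X.2.of_le hle) (Y.2.of_le hle) (Z.2.of_le hle)
    rw [← hb X.2 Y.2, ← hb X.2 Z.2, ← hb Y.2 Z.2, ← hb X.2 (hs Y.2 Z.2), ← hb (hs X.2 Y.2) Z.2,
      ← hb Y.2 (hs X.2 Z.2)] at e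
    exact e
  tr_smulRight α Y := Subtype.ext (traceFun_smulRight α Y)
  eq_zero_of_locally f hf := Subtype.ext <| funext fun x ↦ by
    obtain ⟨χ, k, F, θ, hχ, -, h⟩ := exists_cutoff_eq_sum (I := I) x
    have e : χ.1 x * f.1 x = 0 := congrArg (fun f ↦ f.1 x) (hf χ k F θ h)
    rwa [hχ.self_of_nhds, one_mul] at e

end Metric

end LeviCivita
end

section AlmostContact

variable {E : Type*} [NormedAddCommGroup E] [NormedSpace ℝ E]
  {H : Type*} [TopologicalSpace H] {I : ModelWithCorners ℝ E H}
  {M : Type*} [TopologicalSpace M] [ChartedSpace H M] [IsManifold I ∞ M]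
  [RiemannianBundle (fun x : M ↦ TangentSpace I x)]
  {φ : Π x : M, TangentSpace I x →L[ℝ] TangentSpace I x}
  {ξ : Π x : M, TangentSpace I x} {η : Π x : M, TangentSpace I x →L[ℝ] ℝ}

lemma IsAlmostContactMetric.inner_xi_xi (h : IsAlmostContactMetric φ ξ η) (x : M) :
    inner ℝ (ξ x) (ξ x) = (1 : ℝ) := by
  rw [← h.eta_eq, h.eta_xi]

lemma IsAlmostContactMetric.phi_xi (h : IsAlmostContactMetric φ ξ η) (x : M) :
    φ x (ξ x) = 0 := by
  rw [← inner_self_eq_zero (𝕜 := ℝ), h.inner_phi, h.inner_xi_xi, h.eta_xi]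
  norm_num

lemma IsKenmotsu.covDeriv_xi [FiniteDimensional ℝ E]
    {nabla : CovariantDerivative I E (TangentSpace I : M → Type _)}
    (h : IsKenmotsu nabla φ ξ η) {X : Π x : M, TangentSpace I x}
    (hX : IsSmoothField X) (x : M) : covDeriv nabla X ξ x = X x - η x (X x) • ξ x := by
  have e1 := h.kenmotsu X ξ hX h.smooth_xi x
  have e2 : (fun y ↦ φ y (ξ y)) = 0 := funext fun y ↦ h.phi_xi y
  have e3 : covDeriv nabla X (0 : Π x : M, TangentSpace I x) x = 0 := by simp [covDeriv]
  have e4 : η x (covDeriv nabla X ξ x) = 0 := by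
    have := h.leviCivita.metric X ξ ξ hX h.smooth_xi h.smooth_xi x
    have hc : metricTensor ξ ξ = fun _ ↦ (1 : ℝ) := funext h.inner_xi_xi
    rw [hc, mvfderiv_const, zero_apply, metricTensor, metricTensor,
      real_inner_comm (covDeriv nabla X ξ x) (ξ x)] at this
    rw [h.eta_eq]
    linarith
  rw [e2, e3, h.eta_xi] at e1
  have e5 := congrArg (φ x) e1
  simp only [map_sub, map_neg, map_smul, h.phi_sq, h.phi_xi, e4, smul_zero, zero_smul, add_zero,
    zero_sub, one_smul, neg_neg] at e5
  rw [e5]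
  abel

end AlmostContact

section Kenmotsu

variable {E : Type*} [NormedAddCommGroup E] [NormedSpace ℝ E] [FiniteDimensional ℝ E]
  {H : Type*} [TopologicalSpace H] {I : ModelWithCorners ℝ E H}
  {M : Type*} [TopologicalSpace M] [ChartedSpace H M] [IsManifold I ∞ M] [T2Space M]
  [RiemannianBundle (fun x : M ↦ TangentSpace I x)]
  [IsContMDiffRiemannianBundle I ∞ E (fun x : M ↦ TangentSpace I x)]
  {nabla : CovariantDerivative I E (TangentSpace I : M → Type _)}

lemma IsLeviCivita.coe_br (h : IsLeviCivita nabla) (X Y : smoothFields I M) :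
    (h.fieldAlgebra.br X Y).1 = mlieBracket I X.1 Y.1 :=
  covDeriv_sub_eq_mlieBracket h.torsion_eq_zero X.2 Y.2

lemma IsLeviCivita.coe_tr_curv (h : IsLeviCivita nabla) (Y Z : smoothFields I M) :
    (h.fieldAlgebra.tr (h.fieldAlgebra.curv Y Z)).1 = ricci nabla Y.1 Z.1 := by
  ext x
  have e (X : smoothFields I M) :
      (h.fieldAlgebra.curv Y Z X).1 = curvature nabla X.1 Y.1 Z.1 := by
    rw [curvature, ← h.coe_br X Y]; rfl
  change traceFun _ x = _
  refine Finset.sum_congr rfl fun i _ ↦ ?_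
  rw [e, curvature_congr h.smooth (IsSmoothField.mdifferentiableAt (fieldThrough _).2 x)
    (mdifferentiableAt_extend I E _) Z.2
    ((fieldThrough_apply _).trans (extend_apply_self (F := E) _).symm)]

lemma IsLeviCivita.coe_lie_metric (h : IsLeviCivita nabla) (V X Y : smoothFields I M) :
    (h.fieldAlgebra.lie V (fun X Y ↦ h.fieldAlgebra.g X Y) X Y).1
      = lieDerivTwoTensor V.1 metricTensor X.1 Y.1 := by
  ext x
  rw [lieDerivTwoTensor, ← h.coe_br, ← h.coe_br]; rfl

lemma IsLeviCivita.coe_lie_ricci (h : IsLeviCivita nabla) (V X Y : smoothFields I M) :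
    (h.fieldAlgebra.lie V (fun X Y ↦ h.fieldAlgebra.tr (h.fieldAlgebra.curv X Y)) X Y).1
      = lieDerivTwoTensor V.1 (ricci nabla) X.1 Y.1 := by
  ext x
  rw [lieDerivTwoTensor, ← h.coe_br, ← h.coe_br, ← h.coe_tr_curv, ← h.coe_tr_curv,
    ← h.coe_tr_curv]
  rfl

variable {φ : Π x : M, TangentSpace I x →L[ℝ] TangentSpace I x}
  {ξ : Π x : M, TangentSpace I x} {η : Π x : M, TangentSpace I x →L[ℝ] ℝ}

/-- The Reeb field of a Kenmotsu structure. -/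
lemma IsKenmotsu.isKenmotsuField (h : IsKenmotsu nabla φ ξ η) :
    h.leviCivita.fieldAlgebra.IsKenmotsuField (⟨ξ, h.smooth_xi⟩ : smoothFields I M) where
  unit := Subtype.ext <| funext h.inner_xi_xi
  nab_eq X := Subtype.ext <| funext fun x ↦ by
    have := h.covDeriv_xi X.2 x
    rw [h.eta_eq] at this
    exact this

end Kenmotsu

theorem lie_derivative_ricci_xi_xi_eq_zero_of_conformal_eta_ricci_soliton
    (n : ℕ) {M : Type*} [TopologicalSpace M] [T2Space M] [SecondCountableTopology M]
    [ChartedSpace (EuclideanSpace ℝ (Fin (2 * n + 1))) M] [IsManifold (𝓡 (2 * n + 1)) ∞ M]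
    [RiemannianBundle (fun x : M ↦ TangentSpace (𝓡 (2 * n + 1)) x)]
    [IsContMDiffRiemannianBundle (𝓡 (2 * n + 1)) ∞ (EuclideanSpace ℝ (Fin (2 * n + 1)))
      (fun x : M ↦ TangentSpace (𝓡 (2 * n + 1)) x)]
    (nabla : CovariantDerivative (𝓡 (2 * n + 1)) (EuclideanSpace ℝ (Fin (2 * n + 1)))
      (TangentSpace (𝓡 (2 * n + 1)) : M → Type _))
    (φ : Π x : M, TangentSpace (𝓡 (2 * n + 1)) x →L[ℝ] TangentSpace (𝓡 (2 * n + 1)) x)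
    (ξ : Π x : M, TangentSpace (𝓡 (2 * n + 1)) x)
    (η : Π x : M, TangentSpace (𝓡 (2 * n + 1)) x →L[ℝ] ℝ)
    (hK : IsKenmotsu nabla φ ξ η)
    (V : Π x : M, TangentSpace (𝓡 (2 * n + 1)) x) (lam mu p : ℝ)
    (hV : IsConformalEtaRicciSoliton nabla η V lam mu p) :
    ∀ x : M, lieDerivTwoTensor V (ricci nabla) ξ ξ x = 0 := by
  intro x
  let L := hK.leviCivita.fieldAlgebra
  let ξ' : smoothFields (𝓡 (2 * n + 1)) M := ⟨ξ, hK.smooth_xi⟩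
  let V' : smoothFields (𝓡 (2 * n + 1)) M := ⟨V, hV.smooth⟩
  let r : ℝ := 2 * lam - (p + 2 / (Module.finrank ℝ (EuclideanSpace ℝ (Fin (2 * n + 1))) : ℝ))
  have key := hK.isKenmotsuField.lie_ricci_xi_xi_eq_zero fieldTrace_id (V := V')
    (a := algebraMap ℝ _ r) (k := algebraMap ℝ _ (2 * mu))
    (fun X ↦ (L.D X).map_algebraMap _) (fun X ↦ (L.D X).map_algebraMap _) fun X Y ↦
      Subtype.ext <| funext fun y ↦ by
        have e := hV.eq_zero X.1 Y.1 X.2 Y.2 y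
        rw [hK.eta_eq, hK.eta_eq, ← hK.leviCivita.coe_tr_curv X Y,
          ← hK.leviCivita.coe_lie_metric V' X Y] at e
        exact e
  rw [← hK.leviCivita.coe_lie_ricci V' ξ' ξ']
  exact congrArg (fun f ↦ f.1 x) key
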